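/- arXiv:1511.06478 — 2 statements merged into one kernel-verified Lean document; each statement's English description precedes it below -/
import Mathlib

section
/- If A is a nonempty finite set of integers that is an (r,1)-approximate group for some integer r ≥ 2, then A is an (r,1)-approximate group for every integer r ≥ 2. -/
open Pointwise

/-- The `r`-fold sumset `A + A + ⋯ + A` of a finite set of integers. -/
def hsum (A : Finset ℤ) : ℕ → Finset ℤ
  | 0 => {0}
  | n + 1 => hsum A n + A

/-- `A` is an `(r, ℓ)`-approximate group: there is a set `X` of integers with
`|X| ≤ ℓ` and `rA ⊆ X + A`. -/
def IsApproxGroup (r ℓ : ℕ) (A : Finset ℤ) : Prop :=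
  ∃ X : Finset ℤ, X.card ≤ ℓ ∧ hsum A r ⊆ X + A

theorem natCast_mul_mem_hsum {A : Finset ℤ} {a : ℤ} (ha : a ∈ A) (n : ℕ) :
    (n : ℤ) * a ∈ hsum A n := by
  induction n with
  | zero => simp [hsum]
  | succ n ih =>
    have h := Finset.add_mem_add ih ha
    rw [hsum]
    convert h using 1
    push_cast
    ring

theorem hsum_singleton (a : ℤ) (n : ℕ) : hsum {a} n = {(n : ℤ) * a} := by
  induction n with
  | zero => simp [hsum]
  | succ n ih =>
    rw [hsum, ih, Finset.singleton_add_singleton]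
    push_cast
    ring_nf

theorem isApproxGroup_singleton (r : ℕ) (a : ℤ) : IsApproxGroup r 1 {a} := by
  refine ⟨{(r : ℤ) * a - a}, by simp, ?_⟩
  rw [hsum_singleton, Finset.singleton_add_singleton, sub_add_cancel]

/-- A finite set of integers with a multiple sumset contained in one translate of itself
is a singleton. -/
theorem IsApproxGroup.eq_singleton {A : Finset ℤ} {r : ℕ} (hA : A.Nonempty) (hr : 2 ≤ r)
    (h : IsApproxGroup r 1 A) : ∃ a, A = {a} := by
  obtain ⟨X, hX, hsub⟩ := h
  obtain ⟨x, hx, b, hb, hxb⟩ :=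
    Finset.mem_add.1 (hsub (natCast_mul_mem_hsum (A.max'_mem hA) r))
  obtain ⟨y, hy, c, hc, hyc⟩ :=
    Finset.mem_add.1 (hsub (natCast_mul_mem_hsum (A.min'_mem hA) r))
  obtain rfl := Finset.card_le_one.1 hX x hx y hy
  have hbM := A.le_max' b hb
  have hmc := A.min'_le c hc
  have hr' : (2 : ℤ) ≤ r := by exact_mod_cast hr
  have hMm : A.max' hA ≤ A.min' hA := by nlinarith
  refine ⟨A.min' hA, Finset.eq_singleton_iff_unique_mem.2 ⟨A.min'_mem hA, fun a ha => ?_⟩⟩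
  exact le_antisymm ((A.le_max' a ha).trans hMm) (A.min'_le a ha)

/-- If a nonempty finite set `A` of integers is an `(r,1)`-approximate group for
some integer `r ≥ 2`, then it is an `(r,1)`-approximate group for every integer
`r ≥ 2`. -/
theorem approx_group_r_one_forall_of_exists
    (A : Finset ℤ) (hA : A.Nonempty)
    (h : ∃ r : ℕ, 2 ≤ r ∧ IsApproxGroup r 1 A) :
    ∀ r : ℕ, 2 ≤ r → IsApproxGroup r 1 A := by
  obtain ⟨r, hr, hrA⟩ := h
  obtain ⟨a, rfl⟩ := hrA.eq_singleton hA hr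
  exact fun s _ => isApproxGroup_singleton s a
end

section
/- Let A be a nonempty finite set of nonnegative integers with min(A) = 0, max(A) = a*, and gcd(A) = 1. Then there exist a positive integer h₀, nonnegative integers C and D, and finite sets 𝒞 ⊆ [0, C−2] and 𝒟 ⊆ [0, D−2] of integers such that for all integers h ≥ h₀ the h-fold sumset hA satisfies hA = 𝒞 ∪ [C, h·a* − D] ∪ (h·a* − 𝒟), with {0, h·a*} ∪ [C, h·a* − D] ⊆ hA ⊆ [0, h·a*], and [C, h·a* − D] is a maximal subinterval of hA (i.e., C − 1 ∉ hA and h·a* − D + 1 ∉ hA). -/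
open Pointwise

lemma hsum_mono {A : Finset ℤ} (h0 : 0 ∈ A) : Monotone (hsum A) :=
  monotone_nat_of_le_succ fun _ x hx => by
    simpa [hsum] using Finset.add_mem_add hx h0

lemma add_mem_hsum {A : Finset ℤ} {m n : ℕ} {x y : ℤ} (hx : x ∈ hsum A m)
    (hy : y ∈ hsum A n) : x + y ∈ hsum A (m + n) := by
  induction n generalizing y with
  | zero => simp_all [hsum]
  | succ n ih =>
    obtain ⟨b, hb, c, hc, rfl⟩ := Finset.mem_add.1 hy
    rw [← add_assoc x]
    exact Finset.add_mem_add (ih hb) hc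

lemma mul_mem_hsum {A : Finset ℤ} {a : ℤ} (ha : a ∈ A) (n : ℕ) : n * a ∈ hsum A n := by
  induction n with
  | zero => simp [hsum]
  | succ n ih =>
    have := Finset.add_mem_add ih ha
    push_cast
    rwa [add_mul, one_mul]

lemma nonneg_of_mem_hsum {A : Finset ℤ} (hA : ∀ a ∈ A, 0 ≤ a) {n : ℕ} {x : ℤ}
    (hx : x ∈ hsum A n) : 0 ≤ x := by
  induction n generalizing x with
  | zero => simp_all [hsum]
  | succ n ih =>
    obtain ⟨b, hb, c, hc, rfl⟩ := Finset.mem_add.1 hx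
    exact add_nonneg (ih hb) (hA c hc)

lemma sub_mem_hsum_image {A : Finset ℤ} (a : ℤ) {n : ℕ} {x : ℤ} (hx : x ∈ hsum A n) :
    n * a - x ∈ hsum (A.image (a - ·)) n := by
  induction n generalizing x with
  | zero => simp_all [hsum]
  | succ n ih =>
    obtain ⟨b, hb, c, hc, rfl⟩ := Finset.mem_add.1 hx
    have := Finset.add_mem_add (ih hb) (Finset.mem_image_of_mem (a - ·) hc)
    rwa [show (n : ℤ) * a - b + (a - c) = (n + 1 : ℕ) * a - (b + c) by push_cast; ring] at this

lemma sub_mem_hsum_image_iff {A : Finset ℤ} (a : ℤ) {n : ℕ} {x : ℤ} :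
    n * a - x ∈ hsum (A.image (a - ·)) n ↔ x ∈ hsum A n := by
  refine ⟨fun h => ?_, sub_mem_hsum_image a⟩
  simpa [Finset.image_image, Function.comp_def] using sub_mem_hsum_image a h

/-- A finite set of elements lying in some sumsets lies in a single sumset. -/
lemma exists_subset_hsum {A : Finset ℤ} (h0 : 0 ∈ A) (T : Finset ℤ)
    (hT : ∀ x ∈ T, ∃ n, x ∈ hsum A n) : ∃ n, T ⊆ hsum A n := by
  choose! f hf using hT
  exact ⟨T.sup f, fun x hx => hsum_mono h0 (Finset.le_sup hx) (hf x hx)⟩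

/-- All sufficiently large integers lie in some sumset of a set of coprime nonnegative integers. -/
lemma exists_forall_ge_mem_hsum {A : Finset ℤ} (hA : ∀ a ∈ A, 0 ≤ a)
    (hgcd : ∀ d : ℕ, (∀ a ∈ A, (d : ℤ) ∣ a) → d = 1) :
    ∃ N : ℕ, ∀ x : ℕ, N ≤ x → ∃ n, (x : ℤ) ∈ hsum A n := by
  obtain ⟨N, hN⟩ := Nat.exists_mem_closure_of_ge {n : ℕ | (n : ℤ) ∈ A}
  have hset : Nat.setGcd {n : ℕ | (n : ℤ) ∈ A} = 1 := by
    refine hgcd _ fun a ha => ?_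
    lift a to ℕ using hA a ha
    exact Int.natCast_dvd_natCast.2 (Nat.setGcd_dvd_of_mem ha)
  refine ⟨N, fun x hx => ?_⟩
  refine AddSubmonoid.closure_induction (motive := fun (x : ℕ) _ => ∃ n, (x : ℤ) ∈ hsum A n)
    (fun y hy => ⟨1, by simpa using mul_mem_hsum (Set.mem_ofPred.1 hy) 1⟩) ⟨0, by simp [hsum]⟩ ?_
    (hN x hx (by simp [hset]))
  rintro y z - - ⟨m, hm⟩ ⟨n, hn⟩
  exact ⟨m + n, by simpa using add_mem_hsum hm hn⟩

/-- The structure of the sumsets of `A` near their left endpoint. -/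
lemma exists_left_structure {A : Finset ℤ} (hA : ∀ a ∈ A, 0 ≤ a) (h0 : 0 ∈ A)
    (hgcd : ∀ d : ℕ, (∀ a ∈ A, (d : ℤ) ∣ a) → d = 1) {a : ℤ} (ha : a ∈ A) (hpos : 0 < a) :
    ∃ (C : ℤ) (E : Finset ℤ) (k : ℕ), 0 ≤ C ∧ E ⊆ Finset.Icc 0 (C - 2) ∧
      (∀ h, C - 1 ∉ hsum A h) ∧
      (∀ h, ∀ x ∈ hsum A h, x ≤ C - 2 → x ∈ E) ∧
      (∀ h, k ≤ h → E ⊆ hsum A h) ∧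
      ∀ h, k ≤ h → ∀ x, C ≤ x → x < C + (h - k) * a → x ∈ hsum A h := by
  classical
  have hex := exists_forall_ge_mem_hsum hA hgcd
  set C := Nat.find hex
  have hspec : ∀ x : ℤ, (C : ℤ) ≤ x → ∃ n, x ∈ hsum A n := fun x hx => by
    lift x to ℕ using by omega
    exact Nat.find_spec hex x (by omega)
  have hmiss : ∀ h, (C : ℤ) - 1 ∉ hsum A h := fun h hh => by
    have hnn := nonneg_of_mem_hsum hA hh
    refine Nat.find_min hex (m := C - 1) (by omega) fun x hx => ?_
    obtain h1 | h1 := hx.eq_or_lt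
    · exact ⟨h, by rwa [show (x : ℤ) = C - 1 by omega]⟩
    · exact hspec x (by omega)
  set E := {x ∈ Finset.Icc (0 : ℤ) (C - 2) | ∃ n, x ∈ hsum A n}
  obtain ⟨k, hk⟩ := exists_subset_hsum h0 (E ∪ Finset.Ico (C : ℤ) (C + a)) fun x hx => by
    obtain hx | hx := Finset.mem_union.1 hx
    · exact (Finset.mem_filter.1 hx).2
    · exact hspec x (Finset.mem_Ico.1 hx).1
  refine ⟨C, E, k, by omega, Finset.filter_subset _ _, hmiss, fun h x hx hxC => ?_,
    fun h hh => (Finset.subset_union_left.trans hk).trans (hsum_mono h0 hh),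
    fun h hh x hCx hxC => ?_⟩
  · exact Finset.mem_filter.2 ⟨Finset.mem_Icc.2 ⟨nonneg_of_mem_hsum hA hx, hxC⟩, h, hx⟩
  · have hq : 0 ≤ (x - C) / a := Int.ediv_nonneg (by omega) hpos.le
    have hqlt : (x - C) / a < h - k := Int.ediv_lt_of_lt_mul hpos (by linarith)
    have hr : C + (x - C) % a ∈ hsum A k := hk <| Finset.mem_union_right _ <|
      Finset.mem_Ico.2 ⟨by linarith [Int.emod_nonneg (x - C) hpos.ne'],
        by linarith [Int.emod_lt_of_pos (x - C) hpos]⟩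
    have hx := add_mem_hsum hr (mul_mem_hsum ha ((x - C) / a).toNat)
    rw [Int.toNat_of_nonneg hq,
      show (C : ℤ) + (x - C) % a + (x - C) / a * a = x by
        linarith [Int.emod_add_mul_ediv (x - C) a, mul_comm ((x - C) / a) a]] at hx
    exact hsum_mono h0 (by omega) hx

/-- Fundamental theorem of additive number theory: if `A` is a finite set of
nonnegative integers with `min A = 0`, `max A = a*` and `gcd A = 1`, then there
are a positive integer `h₀`, nonnegative integers `C`, `D`, and finite sets
`𝒞 ⊆ [0, C−2]`, `𝒟 ⊆ [0, D−2]` such that for all `h ≥ h₀`: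
`hA = 𝒞 ∪ [C, h·a* − D] ∪ (h·a* − 𝒟)`, with
`{0, h·a*} ∪ [C, h·a* − D] ⊆ hA ⊆ [0, h·a*]`, and `[C, h·a* − D]` is a maximal
subinterval of `hA`. -/
theorem fundamental_theorem_additive_number_theory
    (A : Finset ℤ) (hA : A.Nonempty) (hnonneg : ∀ a ∈ A, 0 ≤ a)
    (hmin : A.min' hA = 0) (astar : ℤ) (hmax : A.max' hA = astar)
    (hgcd : A.gcd id = 1) :
    ∃ h₀ : ℕ, 0 < h₀ ∧ ∃ C D : ℤ, 0 ≤ C ∧ 0 ≤ D ∧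
      ∃ 𝒞 𝒟 : Finset ℤ,
        (↑𝒞 : Set ℤ) ⊆ Set.Icc 0 (C - 2) ∧
        (↑𝒟 : Set ℤ) ⊆ Set.Icc 0 (D - 2) ∧
        ∀ h : ℕ, h₀ ≤ h →
          hsum A h = 𝒞 ∪ Finset.Icc C ((h : ℤ) * astar - D)
              ∪ 𝒟.image (fun x => (h : ℤ) * astar - x) ∧
          ({0, (h : ℤ) * astar} : Finset ℤ) ∪ Finset.Icc C ((h : ℤ) * astar - D)
              ⊆ hsum A h ∧
          hsum A h ⊆ Finset.Icc 0 ((h : ℤ) * astar) ∧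
          C - 1 ∉ hsum A h ∧
          (h : ℤ) * astar - D + 1 ∉ hsum A h := by
  have h0 : 0 ∈ A := hmin ▸ A.min'_mem hA
  have ha : astar ∈ A := hmax ▸ A.max'_mem hA
  have hle : ∀ a ∈ A, a ≤ astar := fun a h => hmax ▸ A.le_max' a h
  have hcop : ∀ d : ℕ, (∀ a ∈ A, (d : ℤ) ∣ a) → d = 1 := fun d hd => by
    have : (d : ℤ) ∣ A.gcd id := Finset.dvd_gcd hd
    rw [hgcd] at this
    exact Nat.dvd_one.1 (by exact_mod_cast this)
  have hpos : 0 < astar := by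
    refine (hnonneg _ ha).lt_of_ne fun h => ?_
    have := hcop 0 fun a h' => by simp [le_antisymm (h ▸ hle a h') (hnonneg a h')]
    omega
  set B := A.image (astar - ·) with hB
  have hB0 : 0 ∈ B := Finset.mem_image.2 ⟨astar, ha, by simp⟩
  have hBa : astar ∈ B := Finset.mem_image.2 ⟨0, h0, by simp⟩
  have hBnonneg : ∀ b ∈ B, 0 ≤ b := by
    simpa [hB] using hle
  have hBcop : ∀ d : ℕ, (∀ b ∈ B, (d : ℤ) ∣ b) → d = 1 := fun d hd =>
    hcop d fun a h => by
      simpa using dvd_sub (hd _ hBa) (hd _ (Finset.mem_image_of_mem (astar - ·) h))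
  have hrefl : ∀ (h : ℕ) (x : ℤ), h * astar - x ∈ hsum B h ↔ x ∈ hsum A h :=
    fun h x => sub_mem_hsum_image_iff astar
  obtain ⟨C, E, k, hC, hE, hCmiss, hEmem, hEsub, hCmid⟩ :=
    exists_left_structure hnonneg h0 hcop ha hpos
  obtain ⟨D, F, l, hD, hF, hDmiss, hFmem, hFsub, hDmid⟩ :=
    exists_left_structure hBnonneg hB0 hBcop hBa hpos
  refine ⟨k + l + 1, by omega, C, D, hC, hD, E, F, fun x hx => Finset.mem_Icc.1 (hE hx),
    fun x hx => Finset.mem_Icc.1 (hF hx),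
    fun h hh => ?_⟩
  have hmid : Finset.Icc C (h * astar - D) ⊆ hsum A h := fun x hx => by
    obtain ⟨hx1, hx2⟩ := Finset.mem_Icc.1 hx
    by_cases hlt : x < C + (h - k) * astar
    · exact hCmid h (by omega) x hx1 hlt
    · refine (hrefl h x).1 (hDmid h (by omega) _ (by linarith) ?_)
      have hhkl : (k : ℤ) + l + 1 ≤ h := by exact_mod_cast hh
      nlinarith
  have hFimage : F.image (fun x => (h : ℤ) * astar - x) ⊆ hsum A h := fun x hx => by
    obtain ⟨y, hy, rfl⟩ := Finset.mem_image.1 hx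
    exact (hrefl h _).1 (by simpa using hFsub h (by omega) hy)
  have hends : ({0, (h : ℤ) * astar} : Finset ℤ) ⊆ hsum A h := by
    intro x hx
    obtain rfl | rfl : x = 0 ∨ x = h * astar := by simpa using hx
    · simpa using mul_mem_hsum h0 h
    · exact mul_mem_hsum ha h
  have hDmiss' : (h : ℤ) * astar - D + 1 ∉ hsum A h := fun hx =>
    hDmiss h (by convert (hrefl h _).2 hx using 1; ring)
  refine ⟨Finset.Subset.antisymm (fun x hx => ?_)
      (Finset.union_subset (Finset.union_subset (hEsub h (by omega)) hmid) hFimage),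
    Finset.union_subset hends hmid, fun x hx => ?_, hCmiss h, hDmiss'⟩
  · have hx1 : x ≠ C - 1 := fun h' => hCmiss h (h' ▸ hx)
    have hx2 : x ≠ h * astar - D + 1 := fun h' => hDmiss' (h' ▸ hx)
    have hx3 := (hrefl h x).2 hx
    simp only [Finset.mem_union, Finset.mem_Icc, Finset.mem_image]
    by_cases hxC : x ≤ C - 2
    · exact .inl (.inl (hEmem h x hx hxC))
    by_cases hxD : h * astar - x ≤ D - 2
    · exact .inr ⟨_, hFmem h _ hx3 hxD, by ring⟩
    · exact .inl (.inr ⟨by omega, by omega⟩)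
  · exact Finset.mem_Icc.2 ⟨nonneg_of_mem_hsum hnonneg hx,
      by linarith [nonneg_of_mem_hsum hBnonneg ((hrefl h x).2 hx)]⟩
end
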